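/- Let K(x) = 1 − |x|^p for x ∈ ℝ⁴ with p ≥ 4 a real number. Then there is no function u : ℝ⁴ → ℝ, locally bounded and bounded from above, with K e^{4u} ∈ L¹(ℝ⁴), solving u(x) = (1/(8π²)) ∫_{ℝ⁴} log(|y|/|x−y|) K(y) e^{4u(y)} dy + c for some constant c ∈ ℝ. -/

import Mathlib

open MeasureTheory Metric Real

/-- `u ∈ L^∞_loc(ℝⁿ)`: `u` is bounded on every bounded set. -/
def LocBdd {n : ℕ} (w : EuclideanSpace ℝ (Fin n) → ℝ) : Prop :=
  ∀ R : ℝ, ∃ M : ℝ, ∀ x : EuclideanSpace ℝ (Fin n), ‖x‖ ≤ R → |w x| ≤ M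

open Filter Topology

/-- Four-dimensional Euclidean space. -/
abbrev E4 := EuclideanSpace ℝ (Fin 4)

theorem integrable_indicator_ball_inv_norm :
    Integrable (fun z : E4 => (ball (0 : E4) 1).indicator (fun z => ‖z‖⁻¹) z) := by
  have h : (fun z : E4 => (ball (0 : E4) 1).indicator (fun z => ‖z‖⁻¹) z) =
      fun z : E4 => (Set.Iio (1 : ℝ)).indicator (fun t => t⁻¹) ‖z‖ := by
    ext z
    by_cases hz : ‖z‖ < 1 <;> simp [Set.indicator, hz]
  rw [h, integrable_fun_norm_addHaar (volume : Measure E4)]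
  have h2 : IntegrableOn ((Set.Ioo (0 : ℝ) 1).indicator fun _ => (1 : ℝ)) (Set.Ioi 0) := by
    apply Integrable.integrableOn
    rw [integrable_indicator_iff measurableSet_Ioo]
    simp
  refine Integrable.mono' h2 ?_ ?_
  · apply Measurable.aestronglyMeasurable
    exact (measurable_id.pow_const _).smul (measurable_inv.indicator measurableSet_Iio)
  · filter_upwards [ae_restrict_mem measurableSet_Ioi] with t ht
    have ht0 : 0 < t := ht
    by_cases h1 : t < 1
    · have : t ^ 3 * t⁻¹ = t ^ 2 := by field_simp
      simp [Set.indicator, h1, ht0, abs_of_pos ht0, this]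
      nlinarith
    · simp [Set.indicator, h1]

/-- The Riesz potential of order three of an integrable function is controlled by its local
sup norm and its `L¹` norm. -/
theorem exists_riesz_bound : ∃ A : ℝ, 0 ≤ A ∧ ∀ (f : E4 → ℝ) (x : E4) (M : ℝ), Integrable f →
    (∀ y, ‖x - y‖ < 1 → |f y| ≤ M) →
    Integrable (fun y => |f y| * ‖x - y‖⁻¹) ∧
      ∫ y, |f y| * ‖x - y‖⁻¹ ≤ M * A + ∫ y, |f y| := by
  set k : E4 → ℝ := fun z => (ball (0 : E4) 1).indicator (fun z => ‖z‖⁻¹) z with hk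
  have hki : Integrable k := integrable_indicator_ball_inv_norm
  have hk0 : ∀ z, 0 ≤ k z := fun z => Set.indicator_nonneg (fun z _ => by positivity) z
  refine ⟨∫ z, k z, integral_nonneg hk0, fun f x M hf hM => ?_⟩
  have hM0 : 0 ≤ M := (abs_nonneg _).trans (hM x (by simp))
  have hle : ∀ y, |f y| * ‖x - y‖⁻¹ ≤ M * k (x - y) + |f y| := by
    intro y
    by_cases h : ‖x - y‖ < 1
    · have : k (x - y) = ‖x - y‖⁻¹ := by simp [hk, Set.indicator, h]
      rw [this]
      have := mul_le_mul_of_nonneg_right (hM y h) (inv_nonneg.2 (norm_nonneg (x - y)))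
      linarith [abs_nonneg (f y)]
    · have h1 : ‖x - y‖⁻¹ ≤ 1 := inv_le_one_of_one_le₀ (not_lt.1 h)
      have := mul_le_mul_of_nonneg_left h1 (abs_nonneg (f y))
      have := mul_nonneg hM0 (hk0 (x - y))
      linarith
  have hb : Integrable (fun y => M * k (x - y) + |f y|) :=
    ((hki.comp_sub_left x).const_mul M).add hf.abs
  have hi : Integrable (fun y => |f y| * ‖x - y‖⁻¹) := by
    refine hb.mono' ?_ ?_
    · exact hf.abs.aestronglyMeasurable.mul
        (by fun_prop : Measurable fun y => ‖x - y‖⁻¹).aestronglyMeasurable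
    · filter_upwards with y
      rw [Real.norm_of_nonneg (by positivity)]
      exact hle y
  refine ⟨hi, (integral_mono hi hb hle).trans_eq ?_⟩
  rw [integral_add ((hki.comp_sub_left x).const_mul M) hf.abs, integral_const_mul,
    integral_sub_left_eq_self k]

theorem LocBdd.exists_riesz_bound {f : E4 → ℝ} (hb : LocBdd f) (hf : Integrable f) (R : ℝ) :
    ∃ B : ℝ, 0 ≤ B ∧ ∀ x : E4, ‖x‖ ≤ R → Integrable (fun y => |f y| * ‖x - y‖⁻¹) ∧
      ∫ y, |f y| * ‖x - y‖⁻¹ ≤ B := by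
  obtain ⟨A, hA, h⟩ := _root_.exists_riesz_bound
  obtain ⟨M, hM⟩ := hb (R + 1)
  refine ⟨|M| * A + ∫ y, |f y|, by positivity, fun x hx => h f x _ hf fun y hy => ?_⟩
  refine (hM y ?_).trans (le_abs_self M)
  have := norm_sub_norm_le y x
  rw [norm_sub_rev] at this
  linarith

theorem LocBdd.integrable_riesz {f : E4 → ℝ} (hb : LocBdd f) (hf : Integrable f) (x : E4) :
    Integrable (fun y => |f y| * ‖x - y‖⁻¹) := by
  obtain ⟨_, -, h⟩ := hb.exists_riesz_bound hf ‖x‖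
  exact (h x le_rfl).1

theorem abs_log_sub_log_le {a b : ℝ} (ha : 0 < a) (hb : 0 < b) :
    |log a - log b| ≤ |a - b| * (a⁻¹ + b⁻¹) := by
  have key : ∀ {s t : ℝ}, 0 < s → 0 < t → log s - log t ≤ |s - t| * t⁻¹ := by
    intro s t hs ht
    rw [← log_div hs.ne' ht.ne']
    calc log (s / t) ≤ s / t - 1 := log_le_sub_one_of_pos (by positivity)
      _ = (s - t) * t⁻¹ := by field_simp
      _ ≤ _ := by gcongr; exact le_abs_self _
  have h1 := key ha hb
  have h2 := key hb ha
  rw [abs_sub_comm] at h2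
  have h3 : 0 ≤ |a - b| * a⁻¹ := by positivity
  have h4 : 0 ≤ |a - b| * b⁻¹ := by positivity
  rw [abs_le, mul_add]
  constructor <;> linarith

theorem sqrt_sq_add_sq_le (s e : ℝ) (hs : 0 ≤ s) : √(s ^ 2 + e ^ 2) ≤ s + |e| := by
  rw [sqrt_le_left (by positivity)]
  nlinarith [abs_nonneg e, sq_abs e]

theorem abs_log_norm_sub_log_le (x y : E4) (e : ℝ) (hy : y ≠ 0) (hxy : x ≠ y) :
    |log ‖y‖ - log (‖x - y‖ ^ 2 + e ^ 2) / 2| ≤ (‖x‖ + |e|) * (‖y‖⁻¹ + ‖x - y‖⁻¹) := by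
  have hs : 0 < ‖x - y‖ := norm_pos_iff.2 (sub_ne_zero.2 hxy)
  have hy0 : 0 < ‖y‖ := norm_pos_iff.2 hy
  rw [← log_sqrt (by positivity)]
  set b := √(‖x - y‖ ^ 2 + e ^ 2) with hb
  have h1 : ‖x - y‖ ≤ b := le_sqrt_of_sq_le (by nlinarith [sq_nonneg e])
  have h2 : b ≤ ‖x - y‖ + |e| := sqrt_sq_add_sq_le _ _ hs.le
  refine (abs_log_sub_log_le hy0 (hs.trans_le h1)).trans ?_
  have h3 : |‖y‖ - b| ≤ ‖x‖ + |e| := by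
    have a1 := norm_sub_le x y
    have a2 : ‖y‖ ≤ ‖x‖ + ‖x - y‖ := by
      have := norm_sub_le x (x - y); simpa using this
    rw [abs_le]
    constructor <;> linarith [abs_nonneg e]
  gcongr

theorem abs_log_sq_add_sq_sub_le (s e : ℝ) (hs : 0 < s) :
    |log (s ^ 2 + e ^ 2) / 2 - log (s ^ 2) / 2| ≤ |e| * s⁻¹ := by
  rw [← log_sqrt (by positivity), ← log_sqrt (by positivity), sqrt_sq hs.le]
  have h1 : s ≤ √(s ^ 2 + e ^ 2) := le_sqrt_of_sq_le (by nlinarith [sq_nonneg e])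
  have h2 := sqrt_sq_add_sq_le s e hs.le
  have h3 : log s ≤ log √(s ^ 2 + e ^ 2) := log_le_log hs h1
  rw [abs_of_nonneg (by linarith), ← log_div (hs.trans_le h1).ne' hs.ne']
  calc _ ≤ √(s ^ 2 + e ^ 2) / s - 1 := log_le_sub_one_of_pos (div_pos (hs.trans_le h1) hs)
    _ = (√(s ^ 2 + e ^ 2) - s) * s⁻¹ := by field_simp
    _ ≤ _ := by gcongr; linarith

/-- The logarithmic potential of `f`, with kernel regularised at scale `e`. -/
noncomputable def logPotential (f : E4 → ℝ) (e : ℝ) (x : E4) : ℝ :=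
  ∫ y, (log ‖y‖ - log (‖x - y‖ ^ 2 + e ^ 2) / 2) * f y

theorem ae_ne_volume (x : E4) : ∀ᵐ y : E4, y ≠ x := by
  simp [ae_iff]

theorem measurable_logKernel (x : E4) (e : ℝ) :
    Measurable fun y : E4 => log ‖y‖ - log (‖x - y‖ ^ 2 + e ^ 2) / 2 := by
  fun_prop

theorem integrable_logPotential {f : E4 → ℝ} (hb : LocBdd f) (hf : Integrable f) (e : ℝ)
    (x : E4) : Integrable fun y => (log ‖y‖ - log (‖x - y‖ ^ 2 + e ^ 2) / 2) * f y := by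
  have h0 := hb.integrable_riesz hf 0
  simp only [zero_sub, norm_neg] at h0
  refine ((h0.add (hb.integrable_riesz hf x)).const_mul (‖x‖ + |e|)).mono'
    ((measurable_logKernel x e).aestronglyMeasurable.mul hf.aestronglyMeasurable) ?_
  filter_upwards [ae_ne_volume 0, ae_ne_volume x] with y h1 h2
  have := mul_le_mul_of_nonneg_right (abs_log_norm_sub_log_le x y e h1 h2.symm) (abs_nonneg (f y))
  rw [norm_mul, Real.norm_eq_abs, Real.norm_eq_abs, Pi.add_apply]
  linarith

theorem abs_logPotential_sub_le {f : E4 → ℝ} (hb : LocBdd f) (hf : Integrable f) (e : ℝ)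
    (x : E4) :
    |logPotential f e x - logPotential f 0 x| ≤ |e| * ∫ y, |f y| * ‖x - y‖⁻¹ := by
  unfold logPotential
  rw [← integral_sub (integrable_logPotential hb hf e x) (integrable_logPotential hb hf 0 x),
    ← integral_const_mul, ← Real.norm_eq_abs]
  refine norm_integral_le_of_norm_le ((hb.integrable_riesz hf x).const_mul _) ?_
  filter_upwards [ae_ne_volume x] with y h2
  have hs : 0 < ‖x - y‖ := norm_pos_iff.2 (sub_ne_zero.2 h2.symm)
  have := mul_le_mul_of_nonneg_right (abs_log_sq_add_sq_sub_le ‖x - y‖ e hs) (abs_nonneg (f y))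
  rw [← sub_mul, norm_mul, Real.norm_eq_abs, Real.norm_eq_abs, abs_sub_comm]
  simp only [ne_eq, OfNat.ofNat_ne_zero, not_false_eq_true, zero_pow, add_zero]
  rw [show log ‖y‖ - log (‖x - y‖ ^ 2) / 2 - (log ‖y‖ - log (‖x - y‖ ^ 2 + e ^ 2) / 2) =
    log (‖x - y‖ ^ 2 + e ^ 2) / 2 - log (‖x - y‖ ^ 2) / 2 by ring]
  linarith

theorem norm_inv_smul_innerSL_le (z : E4) {e : ℝ} (he : 0 < e) :
    ‖(‖z‖ ^ 2 + e ^ 2)⁻¹ • innerSL ℝ z‖ ≤ e⁻¹ := by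
  rw [norm_smul, innerSL_apply_norm, Real.norm_of_nonneg (by positivity), inv_mul_le_iff₀
    (by positivity)]
  have : (‖z‖ ^ 2 + e ^ 2) * e⁻¹ = ‖z‖ ^ 2 * e⁻¹ + e := by field_simp
  rw [this]
  have h : 2 * ‖z‖ ≤ ‖z‖ ^ 2 * e⁻¹ + e := by
    have : 0 ≤ (‖z‖ - e) ^ 2 * e⁻¹ := by positivity
    have h2 : (‖z‖ - e) ^ 2 * e⁻¹ = ‖z‖ ^ 2 * e⁻¹ + e - 2 * ‖z‖ := by field_simp; ring
    linarith
  linarith [norm_nonneg z]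

theorem hasFDerivAt_logKernel (y : E4) {e : ℝ} (he : 0 < e) (c : ℝ) (x : E4) :
    HasFDerivAt (fun x : E4 => (log ‖y‖ - log (‖x - y‖ ^ 2 + e ^ 2) / 2) * c)
      ((-c) • ((‖x - y‖ ^ 2 + e ^ 2)⁻¹ • innerSL ℝ (x - y))) x := by
  have h1 : HasFDerivAt (fun x : E4 => ‖x - y‖ ^ 2 + e ^ 2) (2 • innerSL ℝ (x - y)) x := by
    have := ((hasStrictFDerivAt_norm_sq (x - y)).hasFDerivAt.comp x
      ((hasFDerivAt_id x).sub_const y)).add_const (e ^ 2)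
    simpa [Function.comp_def] using this
  have h2 := h1.log (by positivity)
  simp only [div_eq_mul_inv]
  refine (((h2.mul_const (2⁻¹ : ℝ)).const_sub (log ‖y‖)).mul_const c).congr_fderiv ?_
  module

theorem hasFDerivAt_logPotential {f : E4 → ℝ} (hb : LocBdd f) (hf : Integrable f) {e : ℝ}
    (he : 0 < e) (x : E4) :
    HasFDerivAt (logPotential f e)
      (∫ y, (-f y) • ((‖x - y‖ ^ 2 + e ^ 2)⁻¹ • innerSL ℝ (x - y))) x ∧
    Integrable fun y => (-f y) • ((‖x - y‖ ^ 2 + e ^ 2)⁻¹ • innerSL ℝ (x - y)) := by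
  have hm : AEStronglyMeasurable
      (fun y => (-f y) • ((‖x - y‖ ^ 2 + e ^ 2)⁻¹ • innerSL ℝ (x - y))) volume := by
    refine hf.aestronglyMeasurable.neg.smul (Continuous.aestronglyMeasurable ?_)
    have h1 : Continuous fun y : E4 => (‖x - y‖ ^ 2 + e ^ 2)⁻¹ :=
      Continuous.inv₀ (by fun_prop) fun y => by positivity
    exact h1.smul ((innerSL ℝ).continuous.comp (by fun_prop))
  have hbd : ∀ x y, ‖(-f y) • ((‖x - y‖ ^ 2 + e ^ 2)⁻¹ • innerSL ℝ (x - y))‖ ≤ |f y| * e⁻¹ := by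
    intro x y
    rw [norm_smul, norm_neg, Real.norm_eq_abs]
    exact mul_le_mul_of_nonneg_left (norm_inv_smul_innerSL_le _ he) (abs_nonneg _)
  refine ⟨?_, (hf.abs.mul_const e⁻¹).mono' hm (Eventually.of_forall (hbd x))⟩
  refine hasFDerivAt_integral_of_dominated_of_fderiv_le (bound := fun y => |f y| * e⁻¹)
    univ_mem (Eventually.of_forall fun x =>
      (integrable_logPotential hb hf e x).aestronglyMeasurable)
    (integrable_logPotential hb hf e x) hm (Eventually.of_forall fun y x _ => hbd x y)
    (hf.abs.mul_const _) (Eventually.of_forall fun y x _ => hasFDerivAt_logKernel y he (f y) x)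

theorem norm_fderiv_logPotential_le {f : E4 → ℝ} (hb : LocBdd f) (hf : Integrable f) {e : ℝ}
    (he : 0 < e) (x : E4) : ‖fderiv ℝ (logPotential f e) x‖ ≤ (∫ y, |f y|) * e⁻¹ := by
  rw [(hasFDerivAt_logPotential hb hf he x).1.fderiv, ← integral_mul_const]
  refine norm_integral_le_of_norm_le (hf.abs.mul_const _) (Eventually.of_forall fun y => ?_)
  rw [norm_smul, norm_neg, Real.norm_eq_abs]
  exact mul_le_mul_of_nonneg_left (norm_inv_smul_innerSL_le _ he) (abs_nonneg _)

theorem fderiv_logPotential_apply {f : E4 → ℝ} (hb : LocBdd f) (hf : Integrable f) {e : ℝ}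
    (he : 0 < e) (x v : E4) : fderiv ℝ (logPotential f e) x v =
      -∫ y, f y * (inner ℝ v (x - y) / (‖x - y‖ ^ 2 + e ^ 2)) := by
  obtain ⟨h1, h2⟩ := hasFDerivAt_logPotential hb hf he x
  rw [h1.fderiv, ContinuousLinearMap.integral_apply h2, ← integral_neg]
  congr 1 with y
  simp only [neg_smul, neg_apply, smul_apply,
    innerSL_apply_apply, smul_eq_mul, real_inner_comm v]
  ring

/-- The divergence theorem for the field `x ↦ H x • x` with `H` compactly supported. -/
theorem integral_four_mul_add_fderiv_self {H : E4 → ℝ} (hd : Differentiable ℝ H)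
    (hc : HasCompactSupport H) {C : ℝ} (hC : ∀ x, ‖fderiv ℝ H x‖ ≤ C) :
    ∫ x, (4 * H x + fderiv ℝ H x x) = 0 := by
  have hHi : Integrable H := hd.continuous.integrable_of_hasCompactSupport hc
  have hci : ∀ i : Fin 4, Continuous fun x : E4 => x i := fun i => by fun_prop
  have hxH : ∀ i : Fin 4, Integrable fun x : E4 => x i * H x := fun i =>
    ((hci i).mul hd.continuous).integrable_of_hasCompactSupport hc.mul_left
  have hK : IsCompact (tsupport H) := hc
  have hi2 : ∀ i : Fin 4, Integrable fun x : E4 =>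
      x i * fderiv ℝ H x (EuclideanSpace.single i 1) := by
    intro i
    obtain ⟨r, hr⟩ := hK.isBounded.exists_norm_le
    have hm : AEStronglyMeasurable
        (fun x : E4 => x i * fderiv ℝ H x (EuclideanSpace.single i 1)) volume :=
      ((hci i).measurable.mul (measurable_fderiv_apply_const ℝ H _)).aestronglyMeasurable
    have : Integrable ((tsupport H).indicator fun _ => r * C) := by
      rw [integrable_indicator_iff hK.measurableSet]
      exact integrableOn_const hK.measure_lt_top.ne
    refine this.mono' hm (Eventually.of_forall fun x => ?_)
    by_cases hx : x ∈ tsupport H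
    · simp only [Set.indicator, hx, if_true, norm_mul]
      have h1 : ‖x i‖ ≤ r := (PiLp.norm_apply_le x i).trans (hr x hx)
      have h2 : ‖fderiv ℝ H x (EuclideanSpace.single i 1)‖ ≤ C := by
        refine ((fderiv ℝ H x).le_opNorm _).trans ?_
        simpa using hC x
      have := (norm_nonneg (x i)).trans h1
      gcongr
    · have : fderiv ℝ H x = 0 := by
        by_contra h
        exact hx (support_fderiv_subset ℝ (by simpa using h))
      simp [this, Set.indicator, hx]
  have hcoord : ∀ i : Fin 4, ∫ x : E4, x i * fderiv ℝ H x (EuclideanSpace.single i 1) =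
      -∫ x, H x := by
    intro i
    have hf : ∀ x : E4, fderiv ℝ (fun x : E4 => x i) x (EuclideanSpace.single i 1) = 1 := by
      intro x
      have : HasFDerivAt (fun x : E4 => x i) (EuclideanSpace.proj i : E4 →L[ℝ] ℝ) x :=
        (EuclideanSpace.proj i : E4 →L[ℝ] ℝ).hasFDerivAt
      rw [this.fderiv]
      simp
    have h := integral_mul_fderiv_eq_neg_fderiv_mul_of_integrable (μ := (volume : Measure E4))
      (f := fun x : E4 => x i) (g := H) (v := EuclideanSpace.single i 1)
      (by simpa [hf] using hHi) (hi2 i) (hxH i) (fun x _ => by fun_prop) (fun x _ => hd x)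
    simpa [hf] using h
  have hexp : ∀ x : E4, fderiv ℝ H x x =
      ∑ i : Fin 4, x i * fderiv ℝ H x (EuclideanSpace.single i 1) := by
    intro x
    have h := congrArg (fderiv ℝ H x) ((EuclideanSpace.basisFun (Fin 4) ℝ).sum_repr x)
    simpa using h.symm
  simp only [hexp]
  rw [integral_add (hHi.const_mul 4) (integrable_finsetSum _ fun i _ => hi2 i),
    integral_finsetSum _ fun i _ => hi2 i, integral_const_mul]
  simp [hcoord]

theorem abs_inner_div_le (v z : E4) (e : ℝ) :
    |inner ℝ v z / (‖z‖ ^ 2 + e ^ 2)| ≤ ‖v‖ * ‖z‖⁻¹ := by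
  rcases eq_or_ne z 0 with rfl | hz
  · simp
  have hz0 : 0 < ‖z‖ := norm_pos_iff.2 hz
  rw [abs_div, abs_of_pos (by positivity : 0 < ‖z‖ ^ 2 + e ^ 2), div_le_iff₀ (by positivity)]
  calc |inner ℝ v z| ≤ ‖v‖ * ‖z‖ := abs_real_inner_le_norm v z
    _ = ‖v‖ * ‖z‖⁻¹ * ‖z‖ ^ 2 := by field_simp
    _ ≤ _ := by gcongr; nlinarith [sq_nonneg e]

/-- The regularised radial derivative kernel, integrated against `f`. -/
noncomputable def radialPotential (f : E4 → ℝ) (e : ℝ) (x : E4) : ℝ :=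
  ∫ y, f y * (inner ℝ x (x - y) / (‖x - y‖ ^ 2 + e ^ 2))

theorem norm_radialKernel_le (f : E4 → ℝ) (e : ℝ) (x y : E4) :
    ‖f y * (inner ℝ x (x - y) / (‖x - y‖ ^ 2 + e ^ 2))‖ ≤ ‖x‖ * (|f y| * ‖x - y‖⁻¹) := by
  rw [norm_mul, Real.norm_eq_abs, Real.norm_eq_abs]
  have := mul_le_mul_of_nonneg_left (abs_inner_div_le x (x - y) e) (abs_nonneg (f y))
  linarith

theorem abs_radialPotential_le {f : E4 → ℝ} {x : E4} {B : ℝ} (e : ℝ)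
    (hi : Integrable fun y => |f y| * ‖x - y‖⁻¹) (hB : ∫ y, |f y| * ‖x - y‖⁻¹ ≤ B) :
    |radialPotential f e x| ≤ ‖x‖ * B := by
  have h : ‖radialPotential f e x‖ ≤ ∫ y, ‖x‖ * (|f y| * ‖x - y‖⁻¹) :=
    norm_integral_le_of_norm_le (hi.const_mul ‖x‖)
      (Eventually.of_forall (norm_radialKernel_le f e x))
  rw [integral_const_mul] at h
  exact h.trans (by gcongr)

theorem tendsto_radialPotential {f : E4 → ℝ} (hb : LocBdd f) (hf : Integrable f) (x : E4)
    {e : ℕ → ℝ} (he : Tendsto e atTop (𝓝 0)) :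
    Tendsto (fun n => radialPotential f (e n) x) atTop (𝓝 (radialPotential f 0 x)) := by
  refine tendsto_integral_of_dominated_convergence (fun y => ‖x‖ * (|f y| * ‖x - y‖⁻¹))
    (fun n => hf.aestronglyMeasurable.mul (Measurable.aestronglyMeasurable (by fun_prop)))
    ((hb.integrable_riesz hf x).const_mul _)
    (fun n => Eventually.of_forall (norm_radialKernel_le f (e n) x)) ?_
  filter_upwards [ae_ne_volume x] with y hy
  have hs : 0 < ‖x - y‖ := norm_pos_iff.2 (sub_ne_zero.2 hy.symm)
  refine Tendsto.const_mul _ (Tendsto.div tendsto_const_nhds ?_ (by positivity))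
  exact (he.pow 2).const_add _

/-- Weak form of the Pohozaev identity for `u = κ * logPotential f 0 + c`, tested against a
compactly supported `G`. -/
theorem integral_exp_mul_euler {f u : E4 → ℝ} {κ c : ℝ} (hb : LocBdd f) (hf : Integrable f)
    (hu : ∀ x, u x = κ * logPotential f 0 x + c) (hub : LocBdd u) {G : E4 → ℝ}
    (hG : ContDiff ℝ 1 G) (hGc : HasCompactSupport G) :
    ∫ x, exp (4 * u x) * (4 * G x + fderiv ℝ G x x) =
      4 * κ * ∫ x, exp (4 * u x) * (G x * radialPotential f 0 x) := by
  set e : ℕ → ℝ := fun n => 1 / ((n : ℝ) + 1) with he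
  have he0 : ∀ n, 0 < e n := fun n => Nat.one_div_pos_of_nat
  have he1 : ∀ n, e n ≤ 1 := fun n => by
    simpa [he] using Nat.one_div_le_one_div (α := ℝ) (Nat.zero_le n)
  have het : Tendsto e atTop (𝓝 0) := tendsto_one_div_add_atTop_nhds_zero_nat
  set v : ℕ → E4 → ℝ := fun n x => κ * logPotential f (e n) x + c with hv
  obtain ⟨r, hr⟩ := (show IsCompact (tsupport G) from hGc).isBounded.exists_norm_le
  obtain ⟨B, hB0, hB⟩ := hb.exists_riesz_bound hf r
  obtain ⟨M, hM⟩ := hub r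
  have hvu : ∀ n x, |v n x - u x| ≤ |κ| * (e n * ∫ y, |f y| * ‖x - y‖⁻¹) := by
    intro n x
    have h := abs_logPotential_sub_le hb hf (e n) x
    rw [abs_of_pos (he0 n)] at h
    rw [hu, hv, show κ * logPotential f (e n) x + c - (κ * logPotential f 0 x + c) =
      κ * (logPotential f (e n) x - logPotential f 0 x) by ring, abs_mul]
    gcongr
  have hvt : ∀ x, Tendsto (fun n => exp (4 * v n x)) atTop (𝓝 (exp (4 * u x))) := by
    intro x
    refine (continuous_exp.tendsto _).comp (Tendsto.const_mul 4 ?_)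
    rw [tendsto_iff_norm_sub_tendsto_zero]
    refine squeeze_zero (fun n => norm_nonneg _) (hvu · x) ?_
    simpa using (het.mul_const (∫ y, |f y| * ‖x - y‖⁻¹)).const_mul |κ|
  set Q := exp (4 * (M + |κ| * B)) with hQ
  have hvQ : ∀ n, ∀ x ∈ tsupport G, exp (4 * v n x) ≤ Q := by
    intro n x hx
    have h1 := (abs_le.1 (hvu n x)).2
    have h2 : e n * ∫ y, |f y| * ‖x - y‖⁻¹ ≤ 1 * B :=
      mul_le_mul (he1 n) (hB x (hr x hx)).2 (integral_nonneg fun y => by positivity) zero_le_one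
    have h3 := mul_le_mul_of_nonneg_left h2 (abs_nonneg κ)
    have h4 := (abs_le.1 (hM x (hr x hx))).2
    rw [hQ, exp_le_exp]
    linarith
  have hG0 : ∀ x ∉ tsupport G, G x = 0 ∧ fderiv ℝ G x = 0 := by
    intro x hx
    refine ⟨image_eq_zero_of_notMem_tsupport hx, ?_⟩
    by_contra h
    exact hx (support_fderiv_subset ℝ (by simpa using h))
  have hGd : Continuous (fderiv ℝ G) := hG.continuous_fderiv one_ne_zero
  have hDc : Continuous fun x => 4 * G x + fderiv ℝ G x x :=
    (hG.continuous.const_mul 4).add (hGd.clm_apply continuous_id)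
  have hDs : HasCompactSupport fun x => 4 * G x + fderiv ℝ G x x :=
    HasCompactSupport.intro hGc fun x hx => by simp [hG0 x hx]
  have hvd : ∀ n x, HasFDerivAt (v n) (κ • fderiv ℝ (logPotential f (e n)) x) x := fun n x =>
    (((hasFDerivAt_logPotential hb hf (he0 n) x).1.differentiableAt.hasFDerivAt.const_mul
      κ).add_const c)
  have hvc : ∀ n, Continuous (v n) := fun n =>
    continuous_iff_continuousAt.2 fun x => (hvd n x).continuousAt
  have hdrad : ∀ n x, fderiv ℝ (logPotential f (e n)) x x = -radialPotential f (e n) x :=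
    fun n x => fderiv_logPotential_apply hb hf (he0 n) x x
  have hradm : ∀ n, Measurable (radialPotential f (e n)) := by
    intro n
    have h : radialPotential f (e n) = fun x => -fderiv ℝ (logPotential f (e n)) x x := by
      ext x; rw [hdrad, neg_neg]
    rw [h]
    exact (ContinuousLinearMap.measurable_apply₂.comp
      ((measurable_fderiv ℝ _).prodMk measurable_id)).neg
  have hAm : ∀ n, AEStronglyMeasurable
      (fun x => exp (4 * v n x) * (4 * G x + fderiv ℝ G x x)) volume := fun n =>
    ((continuous_exp.comp ((hvc n).const_mul 4)).mul hDc).aestronglyMeasurable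
  have hBm : ∀ n, AEStronglyMeasurable
      (fun x => exp (4 * v n x) * (G x * radialPotential f (e n) x)) volume := fun n =>
    (((continuous_exp.comp ((hvc n).const_mul 4)).measurable.mul
      (hG.continuous.measurable.mul (hradm n))).aestronglyMeasurable)
  have hAi : Integrable fun x => Q * |4 * G x + fderiv ℝ G x x| :=
    (hDc.integrable_of_hasCompactSupport hDs).abs.const_mul Q
  have hBi : Integrable fun x => Q * (|G x| * (r * B)) :=
    ((hG.continuous.integrable_of_hasCompactSupport hGc).abs.mul_const (r * B)).const_mul Q
  have hAb : ∀ n x, ‖exp (4 * v n x) * (4 * G x + fderiv ℝ G x x)‖ ≤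
      Q * |4 * G x + fderiv ℝ G x x| := by
    intro n x
    by_cases hx : x ∈ tsupport G
    · rw [norm_mul, Real.norm_of_nonneg (exp_pos _).le, Real.norm_eq_abs]
      gcongr
      exact hvQ n x hx
    · simp [hG0 x hx]
  have hBb : ∀ n x, ‖exp (4 * v n x) * (G x * radialPotential f (e n) x)‖ ≤
      Q * (|G x| * (r * B)) := by
    intro n x
    by_cases hx : x ∈ tsupport G
    · rw [norm_mul, Real.norm_of_nonneg (exp_pos _).le, norm_mul, Real.norm_eq_abs,
        Real.norm_eq_abs]
      have h := hB x (hr x hx)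
      have h2 := abs_radialPotential_le (e n) h.1 h.2
      have h3 : ‖x‖ * B ≤ r * B := by have := hr x hx; gcongr
      have := h2.trans h3
      have := hvQ n x hx
      gcongr
    · simp [hG0 x hx]
  have hid : ∀ n, ∫ x, exp (4 * v n x) * (4 * G x + fderiv ℝ G x x) =
      4 * κ * ∫ x, exp (4 * v n x) * (G x * radialPotential f (e n) x) := by
    intro n
    have hHd : ∀ x, HasFDerivAt (fun x => exp (4 * v n x) * G x)
        (exp (4 * v n x) • fderiv ℝ G x +
          G x • exp (4 * v n x) • (4 : ℝ) • κ • fderiv ℝ (logPotential f (e n)) x) x := fun x =>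
      (((hvd n x).const_mul 4).exp).mul (hG.differentiable one_ne_zero x).hasFDerivAt
    obtain ⟨C1, hC1⟩ := (hGc.fderiv (𝕜 := ℝ)).exists_bound_of_continuous hGd
    obtain ⟨C2, hC2⟩ := hGc.exists_bound_of_continuous hG.continuous
    have h := integral_four_mul_add_fderiv_self (H := fun x => exp (4 * v n x) * G x)
      (fun x => (hHd x).differentiableAt) hGc.mul_left
      (C := Q * C1 + C2 * (Q * (4 * (|κ| * ((∫ y, |f y|) * (e n)⁻¹))))) (fun x => ?_)
    · have hrw : ∀ x, 4 * (exp (4 * v n x) * G x) +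
          fderiv ℝ (fun x => exp (4 * v n x) * G x) x x =
          exp (4 * v n x) * (4 * G x + fderiv ℝ G x x) -
            4 * κ * (exp (4 * v n x) * (G x * radialPotential f (e n) x)) := by
        intro x
        rw [(hHd x).fderiv]
        simp only [add_apply, smul_apply, smul_eq_mul, hdrad]
        ring
      simp only [hrw] at h
      rw [integral_sub (hAi.mono' (hAm n) (Eventually.of_forall (hAb n)))
        ((hBi.mono' (hBm n) (Eventually.of_forall (hBb n))).const_mul _),
        integral_const_mul] at h
      linarith
    · have hC1' := (norm_nonneg _).trans (hC1 0)
      have hC2' := (norm_nonneg _).trans (hC2 0)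
      have hI : 0 ≤ ∫ y, |f y| := integral_nonneg fun y => abs_nonneg _
      have hen := he0 n
      rw [(hHd x).fderiv]
      by_cases hx : x ∈ tsupport G
      · refine (norm_add_le _ _).trans ?_
        simp only [norm_smul, Real.norm_of_nonneg (exp_pos _).le]
        have h1 := hvQ n x hx
        have h2 := norm_fderiv_logPotential_le hb hf (he0 n) x
        have h3 := hC1 x
        have h4 := hC2 x
        rw [Real.norm_eq_abs κ, show ‖(4 : ℝ)‖ = 4 by norm_num]
        gcongr
      · rw [(hG0 x hx).1, (hG0 x hx).2]
        simp only [smul_zero, zero_smul, add_zero, norm_zero]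
        positivity
  have hLA := tendsto_integral_of_dominated_convergence _ hAm hAi
    (fun n => Eventually.of_forall (hAb n))
    (Eventually.of_forall fun x => (hvt x).mul_const (4 * G x + fderiv ℝ G x x))
  have hLB := tendsto_integral_of_dominated_convergence _ hBm hBi
    (fun n => Eventually.of_forall (hBb n))
    (Eventually.of_forall fun x =>
      (hvt x).mul ((tendsto_radialPotential hb hf x het).const_mul (G x)))
  simp only [hid] at hLA
  exact tendsto_nhds_unique hLA (hLB.const_mul (4 * κ))

theorem integrable_radial_prod {f ψ : E4 → ℝ} (hb : LocBdd f) (hf : Integrable f)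
    (hψ : Continuous ψ) (hψc : HasCompactSupport ψ) :
    Integrable (fun z : E4 × E4 => (f z.1 * ψ z.1) *
      (f z.2 * (inner ℝ z.1 (z.1 - z.2) / ‖z.1 - z.2‖ ^ 2))) (volume.prod volume) := by
  have hm : AEStronglyMeasurable (fun z : E4 × E4 => (f z.1 * ψ z.1) *
      (f z.2 * (inner ℝ z.1 (z.1 - z.2) / ‖z.1 - z.2‖ ^ 2))) (volume.prod volume) := by
    refine (hf.aestronglyMeasurable.mul hψ.aestronglyMeasurable).comp_fst.mul
      (hf.aestronglyMeasurable.comp_snd.mul (Measurable.aestronglyMeasurable ?_))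
    fun_prop
  obtain ⟨r, hr0, hr⟩ := (show IsCompact (tsupport ψ) from hψc).isBounded.exists_pos_norm_le
  obtain ⟨B, hB0, hB⟩ := hb.exists_riesz_bound hf r
  obtain ⟨C, hC⟩ := hψc.exists_bound_of_continuous hψ
  have hk : ∀ x y : E4, ‖f y * (inner ℝ x (x - y) / ‖x - y‖ ^ 2)‖ ≤
      ‖x‖ * (|f y| * ‖x - y‖⁻¹) := fun x y => by simpa using norm_radialKernel_le f 0 x y
  have hki : ∀ x : E4, Integrable fun y => f y * (inner ℝ x (x - y) / ‖x - y‖ ^ 2) := fun x =>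
    ((hb.integrable_riesz hf x).const_mul ‖x‖).mono'
      (hf.aestronglyMeasurable.mul (Measurable.aestronglyMeasurable (by fun_prop)))
      (Eventually.of_forall (hk x))
  rw [integrable_prod_iff hm]
  refine ⟨Eventually.of_forall fun x => (hki x).const_mul (f x * ψ x), ?_⟩
  refine (hf.abs.mul_const (C * (r * B))).mono' hm.norm.integral_prod_right'
    (Eventually.of_forall fun x => ?_)
  rw [Real.norm_of_nonneg (integral_nonneg fun y => norm_nonneg _)]
  simp only [norm_mul (f x * ψ x), integral_const_mul]
  by_cases hx : x ∈ tsupport ψ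
  · have h1 : ∫ y, ‖f y * (inner ℝ x (x - y) / ‖x - y‖ ^ 2)‖ ≤ r * B := by
      refine (integral_mono (hki x).norm ((hb.integrable_riesz hf x).const_mul ‖x‖)
        (hk x)).trans ?_
      rw [integral_const_mul]
      have hrx := hr x hx
      have := (norm_nonneg _).trans hrx
      exact mul_le_mul hrx (hB x hrx).2 (integral_nonneg fun y => by positivity) this
    rw [norm_mul, Real.norm_eq_abs, mul_assoc]
    have := (norm_nonneg _).trans (hC x)
    gcongr
    exact hC x
  · have h0 : ψ x = 0 := image_eq_zero_of_notMem_tsupport hx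
    have hC0 := (norm_nonneg _).trans (hC x)
    rw [h0]
    simp only [mul_zero, norm_zero, zero_mul]
    positivity

theorem integral_mul_radialPotential_symm {f ψ : E4 → ℝ} (hb : LocBdd f) (hf : Integrable f)
    (hψ : Continuous ψ) (hψc : HasCompactSupport ψ) :
    ∫ x, f x * ψ x * radialPotential f 0 x = 1 / 2 * ∫ z : E4 × E4, f z.1 * f z.2 *
      (inner ℝ (ψ z.1 • z.1 - ψ z.2 • z.2) (z.1 - z.2) / ‖z.1 - z.2‖ ^ 2) := by
  have hi := integrable_radial_prod hb hf hψ hψc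
  have h1 := integral_prod _ hi
  have h2 := integral_prod_swap (μ := (volume : Measure E4)) (ν := (volume : Measure E4))
    (fun z : E4 × E4 => (f z.1 * ψ z.1) *
      (f z.2 * (inner ℝ z.1 (z.1 - z.2) / ‖z.1 - z.2‖ ^ 2)))
  have h3 := integral_add hi hi.swap
  simp only [Function.comp_apply] at h3
  rw [h2, ← two_mul] at h3
  have h4 : ∫ x, f x * ψ x * radialPotential f 0 x = ∫ z : E4 × E4, (f z.1 * ψ z.1) *
      (f z.2 * (inner ℝ z.1 (z.1 - z.2) / ‖z.1 - z.2‖ ^ 2)) ∂(volume.prod volume) := by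
    rw [h1]
    simp only [integral_const_mul, radialPotential]
    simp
  rw [h4, eq_comm, Measure.volume_eq_prod, one_div, inv_mul_eq_iff_eq_mul₀ two_ne_zero, ← h3]
  congr 1 with z
  simp only [Prod.fst_swap, Prod.snd_swap]
  rw [norm_sub_rev z.2 z.1, inner_sub_left, real_inner_smul_left, real_inner_smul_left,
    ← neg_sub z.1 z.2, inner_neg_right]
  ring

theorem ae_prod_ne : ∀ᵐ z : E4 × E4, z.1 ≠ z.2 := by
  rw [Measure.volume_eq_prod, Measure.ae_prod_iff_ae_ae]
  · exact Eventually.of_forall fun x => (ae_ne_volume x).mono fun y hy => hy.symm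
  · exact (measurableSet_eq_fun measurable_fst measurable_snd).compl

/-- A fixed smooth cutoff, equal to one on the unit ball. -/
noncomputable def cutoff : ContDiffBump (0 : E4) := ⟨1, 2, one_pos, one_lt_two⟩

/-- The cutoff at scale `n + 1`. -/
noncomputable def cutoffAt (n : ℕ) (x : E4) : ℝ := cutoff (((n : ℝ) + 1)⁻¹ • x)

theorem contDiff_cutoffAt (n : ℕ) : ContDiff ℝ 1 (cutoffAt n) :=
  (cutoff.contDiff (n := 1)).comp (contDiff_const_smul _)

theorem hasCompactSupport_cutoffAt (n : ℕ) : HasCompactSupport (cutoffAt n) :=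
  cutoff.hasCompactSupport.comp_smul (by positivity)

theorem abs_cutoffAt_le (n : ℕ) (x : E4) : |cutoffAt n x| ≤ 1 := by
  rw [cutoffAt, abs_of_nonneg cutoff.nonneg]
  exact cutoff.le_one

theorem eventually_cutoffAt_eq_one (x : E4) : ∀ᶠ n in atTop, cutoffAt n =ᶠ[𝓝 x] fun _ => 1 := by
  obtain ⟨N, hN⟩ := exists_nat_gt ‖x‖
  filter_upwards [eventually_ge_atTop N] with n hn
  have h : ∀ᶠ y in 𝓝 x, ‖y‖ < N := continuous_norm.continuousAt.eventually_lt_const hN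
  filter_upwards [h] with y hy
  refine cutoff.one_of_mem_closedBall ?_
  rw [mem_closedBall_zero_iff, norm_smul, Real.norm_of_nonneg (by positivity)]
  change _ ≤ (1 : ℝ)
  rw [inv_mul_le_one₀ (by positivity)]
  have : (N : ℝ) ≤ n := by exact_mod_cast hn
  linarith

theorem exists_lipschitz_cutoffAt : ∃ L : ℝ, ∀ (n : ℕ) (x y : E4),
    ‖cutoffAt n x • x - cutoffAt n y • y‖ ≤ L * ‖x - y‖ := by
  have hc : ContDiff ℝ 1 fun x : E4 => cutoff x • x := (cutoff.contDiff (n := 1)).smul contDiff_id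
  have hs : HasCompactSupport fun x : E4 => cutoff x • x := cutoff.hasCompactSupport.smul_right
  obtain ⟨L, hL⟩ := hc.lipschitzWith_of_hasCompactSupport hs one_ne_zero
  refine ⟨L, fun n x y => ?_⟩
  have hn : 0 < (n : ℝ) + 1 := by positivity
  have h := hL.norm_sub_le (((n : ℝ) + 1)⁻¹ • x) (((n : ℝ) + 1)⁻¹ • y)
  rw [smul_comm, smul_comm (cutoff _), ← smul_sub, ← smul_sub, norm_smul, norm_smul,
    Real.norm_of_nonneg (by positivity)] at h
  have h2 := mul_le_mul_of_nonneg_left h hn.le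
  have e1 : ∀ a : ℝ, ((n : ℝ) + 1) * (((n : ℝ) + 1)⁻¹ * a) = a := fun a => by field_simp
  have e2 : ∀ a b : ℝ, ((n : ℝ) + 1) * (b * (((n : ℝ) + 1)⁻¹ * a)) = b * a := fun a b => by
    field_simp
  rw [e1, e2] at h2
  exact h2

theorem exists_bound_fderiv_cutoffAt : ∃ L : ℝ, ∀ (n : ℕ) (x : E4),
    |fderiv ℝ (cutoffAt n) x x| ≤ L := by
  have hc : Continuous fun x : E4 => fderiv ℝ cutoff x x :=
    ((cutoff.contDiff (n := 1)).continuous_fderiv one_ne_zero).clm_apply continuous_id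
  have hs : HasCompactSupport fun x : E4 => fderiv ℝ cutoff x x :=
    HasCompactSupport.intro (cutoff.hasCompactSupport.fderiv (𝕜 := ℝ)) fun x hx => by
      rw [image_eq_zero_of_notMem_tsupport hx]; rfl
  obtain ⟨L, hL⟩ := hs.exists_bound_of_continuous hc
  refine ⟨L, fun n x => ?_⟩
  have h := hL (((n : ℝ) + 1)⁻¹ • x)
  have : fderiv ℝ (cutoffAt n) x = ((n : ℝ) + 1)⁻¹ • fderiv ℝ cutoff (((n : ℝ) + 1)⁻¹ • x) :=
    fderiv_comp_smul _
  rw [this]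
  simpa using h

theorem tendsto_integral_cutoffAt_radial {f : E4 → ℝ} (hb : LocBdd f) (hf : Integrable f) :
    Tendsto (fun n => ∫ x, f x * cutoffAt n x * radialPotential f 0 x) atTop
      (𝓝 (1 / 2 * (∫ x, f x) ^ 2)) := by
  obtain ⟨L, hL⟩ := exists_lipschitz_cutoffAt
  simp only [fun n => integral_mul_radialPotential_symm hb hf (contDiff_cutoffAt n).continuous
    (hasCompactSupport_cutoffAt n)]
  refine Tendsto.const_mul _ ?_
  rw [sq, ← integral_prod_mul (μ := (volume : Measure E4)) (ν := (volume : Measure E4)),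
    Measure.volume_eq_prod]
  have hff : Integrable (fun z : E4 × E4 => f z.1 * f z.2) (volume.prod volume) := hf.mul_prod hf
  refine tendsto_integral_of_dominated_convergence (fun z => |f z.1 * f z.2| * L) (fun n => ?_)
    (hff.abs.mul_const L) (fun n => Eventually.of_forall fun z => ?_) ?_
  · refine hff.aestronglyMeasurable.mul (Measurable.aestronglyMeasurable ?_)
    have := (contDiff_cutoffAt n).continuous.measurable
    fun_prop
  · rw [norm_mul, Real.norm_eq_abs, Real.norm_eq_abs]
    gcongr
    have h1 := abs_real_inner_le_norm (cutoffAt n z.1 • z.1 - cutoffAt n z.2 • z.2) (z.1 - z.2)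
    have h2 := hL n z.1 z.2
    rcases eq_or_ne z.1 z.2 with h | h
    · have h5 := (norm_nonneg _).trans (hL n (EuclideanSpace.single 0 1) 0)
      simp at h5
      simpa [h] using h5
    · have hs : 0 < ‖z.1 - z.2‖ := norm_pos_iff.2 (sub_ne_zero.2 h)
      rw [abs_div, abs_of_pos (by positivity : 0 < ‖z.1 - z.2‖ ^ 2), div_le_iff₀ (by positivity)]
      nlinarith
  · rw [← Measure.volume_eq_prod]
    filter_upwards [ae_prod_ne] with z hz
    refine tendsto_const_nhds.congr' ?_
    filter_upwards [eventually_cutoffAt_eq_one z.1, eventually_cutoffAt_eq_one z.2] with n h1 h2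
    have hs : 0 < ‖z.1 - z.2‖ := norm_pos_iff.2 (sub_ne_zero.2 hz)
    rw [h1.self_of_nhds, h2.self_of_nhds, one_smul, one_smul, real_inner_self_eq_norm_sq,
      div_self (by positivity), mul_one]

/-- The Pohozaev identity for `K = 1 - |x| ^ p` with weight `exp (4 * u)`. -/
theorem pohozaev {p : ℝ} (hp : 1 < p) {f u : E4 → ℝ} {κ c : ℝ} (hb : LocBdd f)
    (hf : Integrable f) (hfu : ∀ x, f x = (1 - ‖x‖ ^ p) * exp (4 * u x))
    (hu : ∀ x, u x = κ * logPotential f 0 x + c) (hub : LocBdd u)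
    (hw : Integrable fun x => ‖x‖ ^ p * exp (4 * u x)) :
    4 * (∫ x, f x) - p * ∫ x, ‖x‖ ^ p * exp (4 * u x) = 2 * κ * (∫ x, f x) ^ 2 := by
  have hK : ContDiff ℝ 1 fun x : E4 => 1 - ‖x‖ ^ p := contDiff_const.sub (contDiff_norm_rpow hp)
  have hKd : ∀ x : E4, HasFDerivAt (fun x : E4 => 1 - ‖x‖ ^ p)
      (-((p * ‖x‖ ^ (p - 2)) • innerSL ℝ x)) x := fun x =>
    (hasFDerivAt_norm_rpow x hp).const_sub 1
  have hKx : ∀ x : E4, (-((p * ‖x‖ ^ (p - 2)) • innerSL ℝ x)) x = -(p * ‖x‖ ^ p) := by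
    intro x
    simp only [neg_apply, smul_apply, innerSL_apply_apply,
      real_inner_self_eq_norm_sq, smul_eq_mul, neg_inj]
    rcases eq_or_ne x 0 with rfl | hx
    · simp [Real.zero_rpow (by linarith : p ≠ 0)]
    · rw [mul_assoc, ← rpow_natCast, ← rpow_add (norm_pos_iff.2 hx)]
      norm_num
  have hid : ∀ n, ∫ x, (cutoffAt n x * (4 * f x - p * (‖x‖ ^ p * exp (4 * u x))) +
      f x * fderiv ℝ (cutoffAt n) x x) =
      4 * κ * ∫ x, f x * cutoffAt n x * radialPotential f 0 x := by
    intro n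
    have h := integral_exp_mul_euler hb hf hu hub (hK.mul (contDiff_cutoffAt n))
      ((hasCompactSupport_cutoffAt n).mul_left)
    have hd : ∀ x, fderiv ℝ (fun x => (1 - ‖x‖ ^ p) * cutoffAt n x) x x =
        (1 - ‖x‖ ^ p) * fderiv ℝ (cutoffAt n) x x - cutoffAt n x * (p * ‖x‖ ^ p) := by
      intro x
      have : HasFDerivAt (fun x => (1 - ‖x‖ ^ p) * cutoffAt n x) _ x :=
        (hKd x).mul ((contDiff_cutoffAt n).differentiable one_ne_zero x).hasFDerivAt
      rw [this.fderiv, add_apply, smul_apply, smul_apply, hKx,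
        smul_eq_mul, smul_eq_mul]
      ring
    convert h using 2
    · ext x
      rw [hd, hfu]
      ring
    · congr 1 with x
      rw [hfu]
      ring
  obtain ⟨L, hL⟩ := exists_bound_fderiv_cutoffAt
  have hi : Integrable fun x => 4 * f x - p * (‖x‖ ^ p * exp (4 * u x)) :=
    (hf.const_mul 4).sub (hw.const_mul p)
  have hlim : Tendsto (fun n => ∫ x, (cutoffAt n x * (4 * f x - p * (‖x‖ ^ p * exp (4 * u x))) +
      f x * fderiv ℝ (cutoffAt n) x x)) atTop
      (𝓝 (∫ x, (4 * f x - p * (‖x‖ ^ p * exp (4 * u x))))) := by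
    refine tendsto_integral_of_dominated_convergence
      (fun x => |4 * f x - p * (‖x‖ ^ p * exp (4 * u x))| + |f x| * L) (fun n => ?_)
      (hi.abs.add (hf.abs.mul_const L)) (fun n => Eventually.of_forall fun x => ?_)
      (Eventually.of_forall fun x => ?_)
    · refine ((contDiff_cutoffAt n).continuous.aestronglyMeasurable.mul
        hi.aestronglyMeasurable).add (hf.aestronglyMeasurable.mul ?_)
      exact (((contDiff_cutoffAt n).continuous_fderiv one_ne_zero).clm_apply
        continuous_id).aestronglyMeasurable
    · refine (norm_add_le _ _).trans (add_le_add ?_ ?_)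
      · rw [norm_mul, Real.norm_eq_abs, Real.norm_eq_abs]
        exact mul_le_of_le_one_left (abs_nonneg _) (abs_cutoffAt_le n x)
      · rw [norm_mul, Real.norm_eq_abs, Real.norm_eq_abs]
        gcongr
        exact hL n x
    · refine tendsto_const_nhds.congr' ?_
      filter_upwards [eventually_cutoffAt_eq_one x] with n h
      rw [h.self_of_nhds, h.fderiv_eq]
      simp
  simp only [hid] at hlim
  have h := tendsto_nhds_unique hlim ((tendsto_integral_cutoffAt_radial hb hf).const_mul (4 * κ))
  rw [integral_sub (hf.const_mul 4) (hw.const_mul p), integral_const_mul, integral_const_mul] at h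
  rw [h]
  ring

theorem log_add_log_sub_log_le {X s t N : ℝ} (hX : 1 ≤ X) (hs : 0 < s) (ht : 0 < t)
    (hts : t ≤ X + s) (hN : 0 ≤ N) :
    log t - log s + log X ≤ (N + 2) * log X + log 2 + (X ^ N)⁻¹ * s⁻¹ := by
  have hX0 : 0 < X := by linarith
  have ha : 1 ≤ X ^ N := one_le_rpow hX hN
  have ha0 : 0 < X ^ N := by linarith
  have h1 : log t - log s ≤ log (2 * X ^ N * X * exp ((X ^ N)⁻¹ * s⁻¹)) := by
    rw [← log_div ht.ne' hs.ne']
    refine log_le_log (by positivity) ?_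
    have h2 := add_one_le_exp ((X ^ N)⁻¹ * s⁻¹)
    calc t / s ≤ (X + s) / s := by gcongr
      _ = 1 + X * s⁻¹ := by field_simp; ring
      _ ≤ 2 * X ^ N * X + 2 * X * s⁻¹ := by
        have : 0 < X * s⁻¹ := by positivity
        nlinarith
      _ = 2 * X ^ N * X * ((X ^ N)⁻¹ * s⁻¹ + 1) := by field_simp; ring
      _ ≤ _ := by gcongr
  rw [log_mul (by positivity) (exp_pos _).ne', log_mul (by positivity) hX0.ne',
    log_mul two_ne_zero ha0.ne', log_rpow hX0, log_exp] at h1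
  linarith

theorem tendsto_integral_norm_ge {f : E4 → ℝ} (hf : Integrable f) :
    Tendsto (fun n : ℕ => ∫ y in {y : E4 | (n : ℝ) ≤ ‖y‖}, |f y|) atTop (𝓝 0) := by
  have h := tendsto_setIntegral_of_antitone (μ := (volume : Measure E4)) (f := fun y => |f y|)
    (s := fun n : ℕ => {y : E4 | (n : ℝ) ≤ ‖y‖})
    (fun n => measurableSet_le measurable_const measurable_norm)
    (fun m n hmn y (hy : (n : ℝ) ≤ ‖y‖) => (Nat.cast_le.2 hmn).trans hy)
    ⟨0, hf.abs.integrableOn⟩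
  have he : ⋂ n : ℕ, {y : E4 | (n : ℝ) ≤ ‖y‖} = ∅ := by
    ext y
    obtain ⟨n, hn⟩ := exists_nat_gt ‖y‖
    simpa using ⟨n, hn⟩
  rwa [he, setIntegral_empty] at h

theorem logKernel_mul_ge {x y : E4} {a ρ N : ℝ} (hρ : 1 ≤ ρ) (hN : 0 ≤ N) (hx : 2 * ρ ≤ ‖x‖)
    (ha : 1 ≤ ‖y‖ → a ≤ 0) (hy : y ≠ 0) (hxy : x ≠ y) :
    -(|a| * ‖y‖⁻¹ + |a| * (log 2 + log (2 * ρ)) +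
      (N + 2) * log ‖x‖ * {y : E4 | ρ ≤ ‖y‖}.indicator (fun _ => |a|) y +
      (‖x‖ ^ N)⁻¹ * (|a| * ‖x - y‖⁻¹)) ≤ (log ‖y‖ - log ‖x - y‖ + log ‖x‖) * a := by
  have hX : 2 ≤ ‖x‖ := by linarith
  have hy0 : 0 < ‖y‖ := norm_pos_iff.2 hy
  have hs : 0 < ‖x - y‖ := norm_pos_iff.2 (sub_ne_zero.2 hxy)
  have ha0 := abs_nonneg a
  have hl2 : 0 ≤ log 2 := log_nonneg one_le_two
  have hlρ : 0 ≤ log (2 * ρ) := log_nonneg (by linarith)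
  have hlX : 0 ≤ log ‖x‖ := log_nonneg (by linarith)
  have hts : ‖y‖ ≤ ‖x‖ + ‖x - y‖ := by
    have := norm_sub_le x (x - y); simpa using this
  have hst : ‖x - y‖ ≤ ‖x‖ + ‖y‖ := norm_sub_le x y
  have hxs : ‖x‖ ≤ ‖y‖ + ‖x - y‖ := by
    have := norm_add_le y (x - y); simpa using this
  have t1 : 0 ≤ |a| * ‖y‖⁻¹ := by positivity
  have t2 : 0 ≤ |a| * log 2 := by positivity
  have t2' : 0 ≤ |a| * log (2 * ρ) := by positivity
  have t3 : 0 ≤ (‖x‖ ^ N)⁻¹ * (|a| * ‖x - y‖⁻¹) := by positivity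
  have t4 : 0 ≤ {y : E4 | ρ ≤ ‖y‖}.indicator (fun _ => |a|) y :=
    Set.indicator_nonneg (fun _ _ => ha0) _
  have t5 : 0 ≤ (N + 2) * log ‖x‖ * {y : E4 | ρ ≤ ‖y‖}.indicator (fun _ => |a|) y := by
    positivity
  rcases lt_or_ge ‖y‖ 1 with h1 | h1
  · have b1 : -‖y‖⁻¹ ≤ log ‖y‖ := by
      have := one_sub_inv_le_log_of_pos hy0
      linarith
    have b2 : log ‖y‖ ≤ 0 := log_nonpos hy0.le h1.le
    have b3 : log ‖x - y‖ ≤ log ‖x‖ + log 2 := by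
      rw [← log_mul (by linarith) two_ne_zero]
      exact log_le_log hs (by linarith)
    have b4 : log ‖x‖ ≤ log ‖x - y‖ + log 2 := by
      rw [← log_mul hs.ne' two_ne_zero]
      exact log_le_log (by linarith) (by linarith)
    have b5 : |log ‖y‖ - log ‖x - y‖ + log ‖x‖| ≤ ‖y‖⁻¹ + log 2 := by
      have : 0 < ‖y‖⁻¹ := by positivity
      rw [abs_le]; constructor <;> linarith
    have b6 := neg_abs_le ((log ‖y‖ - log ‖x - y‖ + log ‖x‖) * a)
    rw [abs_mul] at b6
    have b7 := mul_le_mul_of_nonneg_right b5 ha0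
    linarith
  · have han := ha h1
    rw [abs_of_nonpos han] at *
    rcases lt_or_ge ‖y‖ ρ with h2 | h2
    · have b1 : log ‖y‖ - log ‖x - y‖ + log ‖x‖ ≤ log (2 * ρ) := by
        have : log ‖y‖ + log ‖x‖ ≤ log (2 * ρ) + log ‖x - y‖ := by
          rw [← log_mul hy0.ne' (by linarith), ← log_mul (by linarith) hs.ne']
          refine log_le_log (by nlinarith) ?_
          have : ‖x‖ ≤ 2 * ‖x - y‖ := by linarith
          nlinarith
        linarith
      have := mul_le_mul_of_nonneg_right b1 ha0
      linarith
    · have b1 := log_add_log_sub_log_le (by linarith : 1 ≤ ‖x‖) hs hy0 hts hN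
      have b2 := mul_le_mul_of_nonneg_right b1 ha0
      have b3 : {y : E4 | ρ ≤ ‖y‖}.indicator (fun _ => -a) y = -a := by
        simp [Set.indicator, h2]
      rw [b3]
      linarith

/-- The logarithmic potential of an `f` that is nonpositive outside the unit ball and grows at
most polynomially is at least `-(∫ f + ε) log |x|`, up to a constant, at infinity. -/
theorem logPotential_ge {f : E4 → ℝ} {N D : ℝ} (hb : LocBdd f) (hf : Integrable f) (hN : 0 ≤ N)
    (hD : ∀ y, |f y| ≤ D * (1 + ‖y‖) ^ N) (hf1 : ∀ y, 1 ≤ ‖y‖ → f y ≤ 0) {ε : ℝ}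
    (hε : 0 < ε) :
    ∃ r C : ℝ, 2 ≤ r ∧ ∀ x : E4, r ≤ ‖x‖ →
      -((∫ y, f y) + ε) * log ‖x‖ - C ≤ logPotential f 0 x := by
  have hD0 : 0 ≤ D := by simpa using (abs_nonneg _).trans (hD 0)
  obtain ⟨A, hA, hriesz⟩ := exists_riesz_bound
  obtain ⟨n, hn, hn1⟩ := (((tendsto_integral_norm_ge hf).eventually_lt_const
    (show 0 < ε / (N + 2) by positivity)).and (eventually_ge_atTop 1)).exists
  rw [lt_div_iff₀ (by positivity)] at hn
  set ρ : ℝ := (n : ℝ) with hρ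
  have hρ1 : 1 ≤ ρ := by rw [hρ]; exact_mod_cast hn1
  set T := ∫ y in {y : E4 | ρ ≤ ‖y‖}, |f y| with hT
  set I := ∫ y, |f y| with hI
  have hI0 : 0 ≤ I := integral_nonneg fun y => abs_nonneg _
  set J := ∫ y, |f y| * ‖y‖⁻¹ with hJ
  refine ⟨2 * ρ, J + I * (log 2 + log (2 * ρ)) + (D * 3 ^ N * A + I), by linarith,
    fun x hx => ?_⟩
  have hX : 2 ≤ ‖x‖ := by linarith
  have hlX : 0 ≤ log ‖x‖ := log_nonneg (by linarith)
  have hms : MeasurableSet {y : E4 | ρ ≤ ‖y‖} := measurableSet_le measurable_const measurable_norm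
  have hi0 : Integrable fun y => |f y| * ‖y‖⁻¹ := by simpa using hb.integrable_riesz hf 0
  obtain ⟨hix, hxB⟩ := hriesz f x (D * (2 + ‖x‖) ^ N) hf fun y hy => by
    have h1 : ‖y‖ ≤ ‖x‖ + ‖x - y‖ := by
      have := norm_sub_le x (x - y); simpa using this
    refine (hD y).trans ?_
    have : 1 + ‖y‖ ≤ 2 + ‖x‖ := by linarith
    gcongr
  have hiT : Integrable fun y => {y : E4 | ρ ≤ ‖y‖}.indicator (fun _ => |f y|) y :=
    hf.abs.indicator hms
  have hTe : ∫ y, {y : E4 | ρ ≤ ‖y‖}.indicator (fun _ => |f y|) y = T :=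
    integral_indicator hms
  have hlog := integrable_logPotential hb hf 0 x
  have hsum : logPotential f 0 x + (∫ y, f y) * log ‖x‖ =
      ∫ y, (log ‖y‖ - log ‖x - y‖ + log ‖x‖) * f y := by
    rw [logPotential, ← integral_mul_const, ← integral_add hlog (hf.mul_const _)]
    congr 1 with y
    simp
    ring
  have hint : Integrable fun y => (log ‖y‖ - log ‖x - y‖ + log ‖x‖) * f y := by
    refine (hlog.add (hf.mul_const (log ‖x‖))).congr (Eventually.of_forall fun y => ?_)
    simp
    ring
  have i12 := hi0.add (hf.abs.mul_const (log 2 + log (2 * ρ)))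
  have i123 := i12.add (hiT.const_mul ((N + 2) * log ‖x‖))
  have i1234 := i123.add (hix.const_mul (‖x‖ ^ N)⁻¹)
  have hge := integral_mono_ae i1234.neg hint (by
    filter_upwards [ae_ne_volume 0, ae_ne_volume x] with y h1 h2
    exact logKernel_mul_ge hρ1 hN hx (hf1 y) h1 h2.symm)
  simp only [Pi.neg_apply] at hge
  rw [integral_neg, integral_add' i123 (hix.const_mul (‖x‖ ^ N)⁻¹),
    integral_add' i12 (hiT.const_mul ((N + 2) * log ‖x‖)),
    integral_add' hi0 (hf.abs.mul_const _), integral_mul_const, integral_const_mul,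
    integral_const_mul, hTe, ← hsum] at hge
  have h1 : (N + 2) * log ‖x‖ * T ≤ ε * log ‖x‖ := by nlinarith
  have h2 : (‖x‖ ^ N)⁻¹ * ∫ y, |f y| * ‖x - y‖⁻¹ ≤ D * 3 ^ N * A + I := by
    have hx0 : 0 < ‖x‖ := by linarith
    have hp1 : 1 ≤ ‖x‖ ^ N := one_le_rpow (by linarith) hN
    rw [inv_mul_le_iff₀ (by positivity)]
    refine hxB.trans ?_
    have h3 : (2 + ‖x‖) ^ N ≤ 3 ^ N * ‖x‖ ^ N := by
      rw [← mul_rpow (by norm_num) hx0.le]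
      exact rpow_le_rpow (by positivity) (by linarith) hN
    have h4 : D * (2 + ‖x‖) ^ N * A ≤ D * (3 ^ N * ‖x‖ ^ N) * A := by gcongr
    nlinarith
  linarith

theorem not_integrable_of_inv_norm_pow_four_le {g : E4 → ℝ} {r a : ℝ} (hr : 0 < r) (ha : 0 < a)
    (hg : ∀ x, r ≤ ‖x‖ → a * (‖x‖ ^ 4)⁻¹ ≤ g x) : ¬ Integrable g := by
  intro hi
  have h1 : Integrable fun x : E4 => (Set.Ici r).indicator (fun t => (t ^ 4)⁻¹) ‖x‖ := by
    refine (hi.abs.const_mul a⁻¹).mono' (Measurable.aestronglyMeasurable ?_)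
      (Eventually.of_forall fun x => ?_)
    · exact ((by fun_prop : Measurable fun t : ℝ => (t ^ 4)⁻¹).indicator
        measurableSet_Ici).comp measurable_norm
    · by_cases h : r ≤ ‖x‖
      · have h2 : ‖(‖x‖ ^ 4)⁻¹‖ = (‖x‖ ^ 4)⁻¹ := Real.norm_of_nonneg (by positivity)
        simp only [Set.indicator, Set.mem_Ici, h, if_true, h2]
        rw [le_inv_mul_iff₀ ha]
        exact (hg x h).trans (le_abs_self _)
      · simp only [Set.indicator, Set.mem_Ici, h, if_false, norm_zero]
        positivity
  rw [integrable_fun_norm_addHaar (volume : Measure E4)] at h1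
  refine not_integrableOn_Ioi_inv (a := r) ?_
  refine (h1.mono_set (Set.Ioi_subset_Ioi hr.le)).congr_fun (fun t ht => ?_) measurableSet_Ioi
  have ht' : r < t := ht
  have : t ≠ 0 := (hr.trans ht').ne'
  simp [Set.indicator, ht'.le]
  field_simp

theorem aestronglyMeasurable_logPotential {f : E4 → ℝ} (hf : Integrable f) (e : ℝ) :
    AEStronglyMeasurable (logPotential f e) volume := by
  have h : AEStronglyMeasurable (fun z : E4 × E4 =>
      (log ‖z.2‖ - log (‖z.1 - z.2‖ ^ 2 + e ^ 2) / 2) * f z.2) (volume.prod volume) :=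
    (Measurable.aestronglyMeasurable (by fun_prop)).mul hf.aestronglyMeasurable.comp_snd
  exact h.integral_prod_right'

theorem integral_log_div_eq_logPotential (f : E4 → ℝ) (x : E4) :
    ∫ y, log (‖y‖ / ‖x - y‖) * f y = logPotential f 0 x := by
  refine integral_congr_ae ?_
  filter_upwards [ae_ne_volume 0, ae_ne_volume x] with y h1 h2
  rw [log_div (norm_ne_zero_iff.2 h1) (norm_ne_zero_iff.2 (sub_ne_zero.2 h2.symm))]
  simp

theorem abs_one_sub_rpow_mul_exp_le {p C t v : ℝ} (hp : 0 ≤ p) (ht : 0 ≤ t) (hv : v ≤ C) :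
    |(1 - t ^ p) * exp (4 * v)| ≤ 2 * exp (4 * C) * (1 + t) ^ p := by
  have h1 : 1 ≤ (1 + t) ^ p := one_le_rpow (by linarith) hp
  have h2 : t ^ p ≤ (1 + t) ^ p := rpow_le_rpow ht (by linarith) hp
  have h3 : 0 ≤ t ^ p := rpow_nonneg ht p
  have h4 : |1 - t ^ p| ≤ 2 * (1 + t) ^ p := by rw [abs_le]; constructor <;> linarith
  have h5 : exp (4 * v) ≤ exp (4 * C) := exp_le_exp.2 (by linarith)
  rw [abs_mul, abs_of_pos (exp_pos _)]
  calc _ ≤ 2 * (1 + t) ^ p * exp (4 * C) := by gcongr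
    _ = _ := by ring

theorem integrable_norm_rpow_mul_exp {p C : ℝ} (hp : 1 ≤ p) {u : E4 → ℝ}
    (hu : AEStronglyMeasurable u volume) (hC : ∀ x, u x ≤ C)
    (hf : Integrable fun x => (1 - ‖x‖ ^ p) * exp (4 * u x)) :
    Integrable fun x => ‖x‖ ^ p * exp (4 * u x) := by
  have hm : AEStronglyMeasurable (fun x : E4 => ‖x‖ ^ p * exp (4 * u x)) volume :=
    (Measurable.aestronglyMeasurable (by fun_prop)).mul
      (continuous_exp.comp_aestronglyMeasurable (hu.const_mul 4))
  have hi : Integrable ((ball (0 : E4) 2).indicator fun _ => (2 : ℝ) ^ p * exp (4 * C)) := by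
    rw [integrable_indicator_iff measurableSet_ball]
    exact integrableOn_const measure_ball_lt_top.ne
  refine ((hf.abs.const_mul 2).add hi).mono' hm (Eventually.of_forall fun x => ?_)
  have h0 : 0 ≤ ‖x‖ ^ p := rpow_nonneg (norm_nonneg x) p
  rw [Real.norm_of_nonneg (by positivity), Pi.add_apply, abs_mul, abs_of_pos (exp_pos _)]
  by_cases h : ‖x‖ < 2
  · have h1 : ‖x‖ ^ p ≤ 2 ^ p := rpow_le_rpow (norm_nonneg x) h.le (by linarith)
    have h2 : exp (4 * u x) ≤ exp (4 * C) := exp_le_exp.2 (by linarith [hC x])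
    have h3 : (ball (0 : E4) 2).indicator (fun _ => (2 : ℝ) ^ p * exp (4 * C)) x =
        2 ^ p * exp (4 * C) := by simp [Set.indicator, h]
    have h4 : ‖x‖ ^ p * exp (4 * u x) ≤ 2 ^ p * exp (4 * C) := by gcongr
    rw [h3]
    have : 0 ≤ 2 * (|1 - ‖x‖ ^ p| * exp (4 * u x)) := by positivity
    linarith
  · have h1 : (2 : ℝ) ≤ ‖x‖ ^ p := calc
      (2 : ℝ) = 2 ^ (1 : ℝ) := (rpow_one 2).symm
      _ ≤ 2 ^ p := rpow_le_rpow_of_exponent_le one_le_two hp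
      _ ≤ ‖x‖ ^ p := rpow_le_rpow zero_le_two (not_lt.1 h) (by linarith)
    have h3 : (ball (0 : E4) 2).indicator (fun _ => (2 : ℝ) ^ p * exp (4 * C)) x = 0 := by
      simp [Set.indicator, h]
    rw [h3, abs_of_nonpos (by linarith)]
    nlinarith [exp_pos (4 * u x)]

/-- (Hyder–Martinazzi) For `K(x) = 1 − |x|^p` on `ℝ⁴` with `p ≥ 4`, there is no locally
bounded, bounded-above solution of
`u(x) = (1/(8π²)) ∫_{ℝ⁴} log(|y|/|x−y|) K(y) e^{4u(y)} dy + c` with `K e^{4u} ∈ L¹(ℝ⁴)`. -/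
theorem no_solution_one_sub_rpow (p : ℝ) (hp : 4 ≤ p) :
    ¬ ∃ (u : EuclideanSpace ℝ (Fin 4) → ℝ) (c C : ℝ),
      LocBdd u ∧ (∀ x, u x ≤ C) ∧
      Integrable (fun y : EuclideanSpace ℝ (Fin 4) =>
        (1 - ‖y‖ ^ p) * Real.exp (4 * u y)) ∧
      (∀ x : EuclideanSpace ℝ (Fin 4),
        u x = (1 / (8 * Real.pi ^ 2)) *
            (∫ y, Real.log (‖y‖ / ‖x - y‖) * ((1 - ‖y‖ ^ p) * Real.exp (4 * u y))) + c) := by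
  rintro ⟨u, c, C, hub, hC, hf, hu⟩
  set κ : ℝ := 1 / (8 * Real.pi ^ 2) with hκ
  have hκ0 : 0 < κ := by positivity
  set f : E4 → ℝ := fun y => (1 - ‖y‖ ^ p) * Real.exp (4 * u y) with hfdef
  have hu' : ∀ x, u x = κ * logPotential f 0 x + c := fun x => by
    rw [← integral_log_div_eq_logPotential]
    exact hu x
  have hD : ∀ y, |f y| ≤ 2 * exp (4 * C) * (1 + ‖y‖) ^ p := fun y =>
    abs_one_sub_rpow_mul_exp_le (by linarith) (norm_nonneg y) (hC y)
  have hb : LocBdd f := fun R => ⟨2 * exp (4 * C) * (1 + R) ^ p, fun y hy => by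
    refine (hD y).trans ?_
    have : 0 ≤ p := by linarith
    gcongr⟩
  have hum : AEStronglyMeasurable u volume := by
    rw [show u = fun x => κ * logPotential f 0 x + c from funext hu']
    exact ((aestronglyMeasurable_logPotential hf 0).const_mul κ).add_const c
  have hw := integrable_norm_rpow_mul_exp (by linarith) hum hC hf
  have hI : 0 < ∫ x, ‖x‖ ^ p * exp (4 * u x) := by
    rw [integral_pos_iff_support_of_nonneg (fun x => by positivity) hw]
    have hsub : ball (EuclideanSpace.single (0 : Fin 4) (2 : ℝ)) 1 ⊆
        Function.support fun x : E4 => ‖x‖ ^ p * exp (4 * u x) := by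
      intro x hx
      have hx0 : x ≠ 0 := by
        rintro rfl
        simp at hx
      have := norm_pos_iff.2 hx0
      exact (by positivity : 0 < ‖x‖ ^ p * exp (4 * u x)).ne'
    exact (measure_ball_pos volume _ one_pos).trans_le (measure_mono hsub)
  have hpoh := pohozaev (by linarith) hb hf (fun _ => rfl) hu' hub hw
  set Λ := ∫ x, f x with hΛ
  have hpI : 0 < p * ∫ x, ‖x‖ ^ p * exp (4 * u x) := by positivity
  have hΛ0 : 0 < Λ := by
    have : 0 ≤ 2 * κ * Λ ^ 2 := by positivity
    linarith
  have hΛ2 : κ * Λ < 2 := by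
    have h : 0 < Λ * (2 * (2 - κ * Λ)) := by linarith
    linarith [(pos_iff_pos_of_mul_pos h).1 hΛ0]
  obtain ⟨r, A, hr, hA⟩ := logPotential_ge hb hf (by linarith : 0 ≤ p) hD
    (fun y hy => mul_nonpos_of_nonpos_of_nonneg
      (sub_nonpos.2 (one_le_rpow hy (by linarith))) (exp_pos _).le)
    (ε := (2 - κ * Λ) / κ) (div_pos (by linarith) hκ0)
  refine not_integrable_of_inv_norm_pow_four_le (r := r) (a := exp (4 * (c - κ * A)))
    (by linarith) (exp_pos _) (fun x hx => ?_) hw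
  have hx1 : 1 ≤ ‖x‖ := by linarith
  have hx0 : 0 < ‖x‖ := by linarith
  have h1 : -2 * log ‖x‖ + (c - κ * A) ≤ u x := by
    rw [hu' x]
    have h2 := mul_le_mul_of_nonneg_left (hA x hx) hκ0.le
    have h3 : κ * (-(Λ + (2 - κ * Λ) / κ) * log ‖x‖ - A) = -2 * log ‖x‖ - κ * A := by
      field_simp
      ring
    rw [h3] at h2
    linarith
  have h4 : exp (4 * (c - κ * A)) * (‖x‖ ^ 8)⁻¹ ≤ exp (4 * u x) := by
    rw [← exp_log (by positivity : 0 < (‖x‖ ^ 8)⁻¹), ← exp_add, exp_le_exp, log_inv, log_pow]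
    push_cast
    linarith
  have h5 : ‖x‖ ^ 4 ≤ ‖x‖ ^ p := by
    rw [← rpow_natCast]
    exact rpow_le_rpow_of_exponent_le hx1 (by exact_mod_cast hp)
  calc exp (4 * (c - κ * A)) * (‖x‖ ^ 4)⁻¹
      = ‖x‖ ^ 4 * (exp (4 * (c - κ * A)) * (‖x‖ ^ 8)⁻¹) := by field_simp
    _ ≤ ‖x‖ ^ p * exp (4 * u x) := by gcongr
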